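/- Let ω be a weight map and j an integer with 0 ≤ j < ω(P). The composite map b_j ∘ b_j is a closure operator on 𝔄_▽(P): it is order-preserving with respect to the order of 𝔄_▽(P), it satisfies A ≤ b_j(b_j(A)) in 𝔄_▽(P) for every antichain A, and it is idempotent, i.e., b_j(b_j(b_j(b_j(A)))) = b_j(b_j(A)) for every antichain A. -/

import Mathlib

open scoped Classical

variable {α : Type*}

/-- The order ideal generated by a subset `S` of a poset. -/
def idl [PartialOrder α] (S : Set α) : Set α := {p | ∃ s ∈ S, p ≤ s}

/-- The order filter generated by a subset `S` of a poset. -/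
def filt [PartialOrder α] (S : Set α) : Set α := {p | ∃ s ∈ S, s ≤ p}

/-- The set of maximal elements of a subposet. -/
def maxOf [PartialOrder α] (S : Set α) : Set α := {x | x ∈ S ∧ ∀ y ∈ S, x ≤ y → x = y}

/-- The set of minimal elements of a subposet. -/
def minOf [PartialOrder α] (S : Set α) : Set α := {x | x ∈ S ∧ ∀ y ∈ S, y ≤ x → x = y}

/-- The meet `A ∧_▵ B := max (𝔍(A) ∩ 𝔍(B))` of antichains in `𝔄_▵(P)`. -/
def meetT [PartialOrder α] (A B : Set α) : Set α := maxOf (idl A ∩ idl B)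

/-- A weight map `ω` on antichains of `P`: `ω(∅) = -1`, `ω({⊥}) = 0`, and
`0 < ω(A') ≤ ω(A'')` whenever `{⊥} < A' ≤ A''` in `𝔄_▵(P)`. -/
structure WeightMap (α : Type*) [PartialOrder α] [OrderBot α] where
  w : Set α → ℤ
  w_empty : w (∅ : Set α) = -1
  w_bot : w ({⊥} : Set α) = 0
  w_pos_mono : ∀ A' A'' : Set α, IsAntichain (· ≤ ·) A' → IsAntichain (· ≤ ·) A'' →
    idl ({⊥} : Set α) ⊂ idl A' → idl A' ⊆ idl A'' → 0 < w A' ∧ w A' ≤ w A''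

/-- The subposet `I_r(P,A;ω)` of relatively `r`-blocking elements for `A` in `P`. -/
noncomputable def relBlock [PartialOrder α] [OrderBot α] (ω : WeightMap α) (r : ℚ)
    (A : Set α) : Set α :=
  if A = ∅ then Set.univ
  else if A = ({⊥} : Set α) then ∅
  else {b | b ≠ ⊥ ∧ ∀ a ∈ A \ {⊥}, r < (ω.w (meetT {b} {a}) : ℚ) / (ω.w {b} : ℚ)}

/-- The absolute `j`-blocker map `b_j` on antichains: a nontrivial antichain `A` is sent to
`min {b ∈ P : ω({b} ∧_▵ {a}) > j for all a ∈ A}`, and `∅ ↦ {⊥}`, `{⊥} ↦ ∅`. -/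
noncomputable def bj [PartialOrder α] [OrderBot α] (ω : WeightMap α) (j : ℤ)
    (A : Set α) : Set α :=
  if A = ∅ then ({⊥} : Set α)
  else if A = ({⊥} : Set α) then ∅
  else minOf {b | ∀ a ∈ A, j < ω.w (meetT {b} {a})}

/-- The set of all `b` whose meet with every element of `A` has weight greater than `j`. -/
def blockers [PartialOrder α] [OrderBot α] (ω : WeightMap α) (j : ℤ) (A : Set α) : Set α :=
  {b | ∀ a ∈ A, j < ω.w (meetT {b} {a})}

theorem meetT_comm [PartialOrder α] (A B : Set α) : meetT A B = meetT B A := by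
  rw [meetT, meetT, Set.inter_comm]

theorem mem_idl_singleton [PartialOrder α] {a p : α} : p ∈ idl ({a} : Set α) ↔ p ≤ a := by
  simp [idl]

theorem isAntichain_meetT [PartialOrder α] (A B : Set α) : IsAntichain (· ≤ ·) (meetT A B) :=
  fun _ hx _ hy hne hle => hne (hx.2 _ hy.1 hle)

theorem idl_meetT [Finite α] [PartialOrder α] (A B : Set α) :
    idl (meetT A B) = idl A ∩ idl B := by
  ext p
  constructor
  · rintro ⟨s, ⟨⟨⟨a, ha, hsa⟩, ⟨b, hb, hsb⟩⟩, -⟩, hps⟩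
    exact ⟨⟨a, ha, hps.trans hsa⟩, ⟨b, hb, hps.trans hsb⟩⟩
  · intro hp
    obtain ⟨m, hpm, hm⟩ := (Set.toFinite (idl A ∩ idl B)).exists_le_maximal hp
    exact ⟨m, ⟨hm.prop, fun y hy hmy => hm.eq_of_le hy hmy⟩, hpm⟩

theorem meetT_bot [PartialOrder α] [OrderBot α] (b : α) :
    meetT {b} {(⊥ : α)} = {⊥} := by
  ext x
  simp only [meetT, maxOf, Set.mem_inter_iff, mem_idl_singleton, Set.mem_ofPred_eq,
    Set.mem_singleton_iff, le_bot_iff]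
  constructor
  · exact fun h => h.1.2
  · rintro rfl
    exact ⟨⟨bot_le, rfl⟩, fun y hy _ => hy.2.symm⟩

theorem lt_weight_meetT_mono [Finite α] [PartialOrder α] [OrderBot α] (ω : WeightMap α) {j : ℤ}
    (hj0 : 0 ≤ j) {a b c : α} (hbc : b ≤ c) (h : j < ω.w (meetT {b} {a})) :
    j < ω.w (meetT {c} {a}) := by
  refine h.trans_le (ω.w_pos_mono _ _ (isAntichain_meetT _ _) (isAntichain_meetT _ _) ?_ ?_).2
  · rw [idl_meetT]
    refine ⟨fun p hp => ?_, fun hsub => ?_⟩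
    · obtain rfl := le_bot_iff.1 (mem_idl_singleton.1 hp)
      exact ⟨mem_idl_singleton.2 bot_le, mem_idl_singleton.2 bot_le⟩
    · have heq : meetT {b} {a} = ({⊥} : Set α) := by
        ext x
        constructor
        · exact fun hx => le_bot_iff.1 (mem_idl_singleton.1 (hsub hx.1))
        · rintro rfl
          exact ⟨⟨mem_idl_singleton.2 bot_le, mem_idl_singleton.2 bot_le⟩, fun y hy _ =>
            (le_bot_iff.1 (mem_idl_singleton.1 (hsub hy))).symm⟩
      rw [heq, ω.w_bot] at h
      omega
  · rw [idl_meetT, idl_meetT]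
    rintro p ⟨hb, ha⟩
    exact ⟨mem_idl_singleton.2 ((mem_idl_singleton.1 hb).trans hbc), ha⟩

theorem bj_eq_minOf_blockers [PartialOrder α] [OrderBot α] (ω : WeightMap α) {j : ℤ}
    (hj0 : 0 ≤ j) (A : Set α) : bj ω j A = minOf (blockers ω j A) := by
  unfold bj
  split_ifs with h h'
  · subst h
    ext x
    simp only [blockers, minOf, Set.mem_singleton_iff, Set.mem_ofPred_eq, Set.mem_empty_iff_false,
      false_imp_iff, implies_true, true_and, true_imp_iff]
    exact ⟨fun hx y hy => by subst hx; exact (le_bot_iff.1 hy).symm, fun hx => hx ⊥ bot_le⟩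
  · subst h'
    symm
    refine Set.eq_empty_iff_forall_notMem.2 fun x hx => ?_
    have := hx.1 ⊥ rfl
    rw [meetT_bot, ω.w_bot] at this
    omega
  · rfl

theorem filt_bj [Finite α] [PartialOrder α] [OrderBot α] (ω : WeightMap α) {j : ℤ}
    (hj0 : 0 ≤ j) (A : Set α) : filt (bj ω j A) = blockers ω j A := by
  rw [bj_eq_minOf_blockers ω hj0]
  ext p
  constructor
  · rintro ⟨s, hs, hsp⟩ a ha
    exact lt_weight_meetT_mono ω hj0 hsp (hs.1 a ha)
  · intro hp
    obtain ⟨m, hmp, hm⟩ := (Set.toFinite (blockers ω j A)).exists_le_minimal hp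
    exact ⟨m, ⟨hm.prop, fun y hy hym => hm.eq_of_ge hy hym⟩, hmp⟩

theorem subset_filt [PartialOrder α] (A : Set α) : A ⊆ filt A := fun a ha => ⟨a, ha, le_rfl⟩

theorem blockers_anti [PartialOrder α] [OrderBot α] (ω : WeightMap α) (j : ℤ) {A C : Set α}
    (h : A ⊆ C) : blockers ω j C ⊆ blockers ω j A := fun _ hb a ha => hb a (h ha)

theorem subset_blockers_blockers [PartialOrder α] [OrderBot α] (ω : WeightMap α) (j : ℤ)
    (A : Set α) : A ⊆ blockers ω j (blockers ω j A) := fun a ha b hb => by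
  rw [meetT_comm]
  exact hb a ha

theorem blockers_blockers_blockers [PartialOrder α] [OrderBot α] (ω : WeightMap α) (j : ℤ)
    (A : Set α) : blockers ω j (blockers ω j (blockers ω j A)) = blockers ω j A :=
  (blockers_anti ω j (subset_blockers_blockers ω j A)).antisymm
    (subset_blockers_blockers ω j _)

theorem blockers_filt [Finite α] [PartialOrder α] [OrderBot α] (ω : WeightMap α) {j : ℤ}
    (hj0 : 0 ≤ j) (A : Set α) : blockers ω j (filt A) = blockers ω j A := by
  refine (blockers_anti ω j (subset_filt A)).antisymm ?_
  rintro b hb a ⟨s, hs, hsa⟩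
  have := hb s hs
  rw [meetT_comm] at this ⊢
  exact lt_weight_meetT_mono ω hj0 hsa this

theorem blockers_bj [Finite α] [PartialOrder α] [OrderBot α] (ω : WeightMap α) {j : ℤ}
    (hj0 : 0 ≤ j) (A : Set α) : blockers ω j (bj ω j A) = blockers ω j (blockers ω j A) := by
  rw [← blockers_filt ω hj0 (bj ω j A), filt_bj ω hj0]

/-- `b_j ∘ b_j` is a closure operator on `𝔄_▽(P)`: order-preserving for the order of
`𝔄_▽(P)`, extensive (`A ≤ b_j(b_j(A))`), and idempotent. -/
theorem stmt_5 [Fintype α] [PartialOrder α] [BoundedOrder α] [Nontrivial α]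
    (ω : WeightMap α) (j : ℤ) (hj0 : 0 ≤ j) (hj : j < ω.w ({⊤} : Set α)) :
    (∀ A C : Set α, IsAntichain (· ≤ ·) A → IsAntichain (· ≤ ·) C → filt A ⊆ filt C →
        filt (bj ω j (bj ω j A)) ⊆ filt (bj ω j (bj ω j C))) ∧
    (∀ A : Set α, IsAntichain (· ≤ ·) A → filt A ⊆ filt (bj ω j (bj ω j A))) ∧
    (∀ A : Set α, IsAntichain (· ≤ ·) A →
        bj ω j (bj ω j (bj ω j (bj ω j A))) = bj ω j (bj ω j A)) := by
  refine ⟨fun A C _ _ h => ?_, fun A _ => ?_, fun A _ => ?_⟩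
  · rw [filt_bj ω hj0, filt_bj ω hj0, blockers_bj ω hj0, blockers_bj ω hj0,
      ← blockers_filt ω hj0 A, ← blockers_filt ω hj0 C]
    exact blockers_anti ω j (blockers_anti ω j h)
  · rw [filt_bj ω hj0, blockers_bj ω hj0, ← blockers_filt ω hj0 A]
    exact subset_blockers_blockers ω j _
  · have key : ∀ S, bj ω j (bj ω j S) = minOf (blockers ω j (blockers ω j S)) := fun S => by
      rw [bj_eq_minOf_blockers ω hj0 (bj ω j S), blockers_bj ω hj0]
    rw [key (bj ω j (bj ω j A)), blockers_bj ω hj0, blockers_bj ω hj0,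
      blockers_blockers_blockers, key]
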